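/- Let J1 = H_3(C1,γ1) and J2 = H_3(C2,γ2) be reduced Albert algebras over a field F of characteristic not 2 or 3, and let ζ1, ζ2 ∈ F^×. Then B(J1,F×F,ζ1) and B(J2,F×F,ζ2) are isomorphic as F-algebras with involution (a bijective F-linear map preserving products and commuting with the involutions) if and only if there exists a norm similarity J1 → J2 whose multiplier is ζ1/ζ2 or ζ1/ζ2². -/

import Mathlib

set_option synthInstance.maxHeartbeats 1000000
set_option maxHeartbeats 1000000

noncomputable section

open scoped TensorProduct

universe u v

structure OctonionAlgebra (F : Type u) [Field F] : Type (max u (v + 1)) where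
  C : Type v
  [ringC : NonAssocRing C]
  [modC : Module F C]
  [sccC : SMulCommClass F C C]
  [istC : IsScalarTower F C C]
  n : QuadraticForm F C
  finrank_eq : Module.finrank F C = 8
  nondeg : ∀ x : C, (∀ y : C, QuadraticMap.polar (⇑n) x y = 0) → x = 0
  n_one : n 1 = 1
  n_mul : ∀ x y : C, n (x * y) = n x * n y

attribute [instance] OctonionAlgebra.ringC OctonionAlgebra.modC OctonionAlgebra.sccC
  OctonionAlgebra.istC

namespace OctonionAlgebra

variable {F : Type u} [Field F] (O : OctonionAlgebra.{u, v} F)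

/-- Conjugation `x̄ := n(x,1)•1 - x` (bundled as a linear map; `polarBilin n x 1 = n(x,1)`). -/
def conj : O.C →ₗ[F] O.C :=
  (LinearMap.toSpanSingleton F O.C (1 : O.C)).comp ((QuadraticMap.polarBilin O.n).flip 1)
    - LinearMap.id

lemma conj_apply (x : O.C) :
    O.conj x = QuadraticMap.polar (⇑O.n) x 1 • (1 : O.C) - x := rfl

/-- A split octonion algebra: the norm form is isotropic. -/
def IsSplit : Prop := ∃ x : O.C, x ≠ 0 ∧ O.n x = 0

end OctonionAlgebra

/-- A reduced Albert algebra `H₃(C,γ)`. -/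
structure ReducedAlbert (F : Type u) [Field F] : Type (max u (v + 1)) where
  O : OctonionAlgebra.{u, v} F
  γ : Fin 3 → Fˣ

namespace ReducedAlbert

variable {F : Type u} [Field F] (A : ReducedAlbert.{u, v} F)

/-- The ambient space of 3×3 matrices over the octonion algebra. -/
abbrev M : Type v := Matrix (Fin 3) (Fin 3) A.O.C

/-- The 27-dimensional space `H₃(C,γ)` of `γ`-hermitian matrices:
`x = γ⁻¹ ⬝ (x̄)ᵀ ⬝ γ`, i.e. entrywise `x i j = γᵢ⁻¹ γⱼ • conj (x j i)`. -/
def J : Submodule F A.M where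
  carrier := {x | ∀ i j, x i j = ((A.γ i : F)⁻¹ * (A.γ j : F)) • A.O.conj (x j i)}
  add_mem' := by
    intro a b ha hb i j
    show a i j + b i j = ((A.γ i : F)⁻¹ * (A.γ j : F)) • A.O.conj (a j i + b j i)
    rw [map_add, smul_add, ← ha i j, ← hb i j]
  zero_mem' := by
    intro i j
    show (0 : A.O.C) = ((A.γ i : F)⁻¹ * (A.γ j : F)) • A.O.conj (0 : A.O.C)
    rw [map_zero, smul_zero]
  smul_mem' := by
    intro c a ha i j
    show c • a i j = ((A.γ i : F)⁻¹ * (A.γ j : F)) • A.O.conj (c • a j i)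
    rw [map_smul, smul_comm, ← ha i j]

/-- The Jordan product `x·y := (xy + yx)/2`. -/
def jmul (x y : A.M) : A.M := (2 : F)⁻¹ • (x * y + y * x)

/-- The trace `T(x)`: the sum of the diagonal entries, which for hermitian matrices are
scalars `ε•1`; the scalar `ε` is recovered as `n(ε•1, 1)/2`. -/
def trace (x : A.M) : F := (2 : F)⁻¹ * ∑ i, QuadraticMap.polar (⇑A.O.n) (x i i) 1

/-- The trace bilinear form `T(x,y) := T(x·y)`. -/
def tb (x y : A.M) : F := A.trace (A.jmul x y)

/-- The adjoint `x ^ # = x·x − T(x)·x + ½(T(x)² − T(x,x))·1`, the unique quadratic map such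
that `T(x^#, y)` is the coefficient of `s` in `N(x + s y)`. -/
def sharp (x : A.M) : A.M :=
  A.jmul x x - A.trace x • x + ((2 : F)⁻¹ * (A.trace x ^ 2 - A.tb x x)) • (1 : A.M)

/-- The Freudenthal cross product `x × y := (x+y)^# − x^# − y^#`. -/
def cross (x y : A.M) : A.M := A.sharp (x + y) - A.sharp x - A.sharp y

/-- The cubic norm `N`, defined pointwise on `J` by
`N(x)·1 = x·(x·x) − T(x)·(x·x) + ½(T(x)² − T(x,x))·x`; the scalar is recovered by
applying the trace (which takes value `3` on `1`). -/
def norm (x : A.M) : F :=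
  (3 : F)⁻¹ * A.trace (A.jmul x (A.jmul x x) - A.trace x • A.jmul x x
    + ((2 : F)⁻¹ * (A.trace x ^ 2 - A.tb x x)) • x)

/-- The operator `⟨x,y⟩(j) := ½ (y × (x × j) − T(j,y)·x − ⅓·T(x,y)·j)`. -/
def brok (x y j : A.M) : A.M :=
  (2 : F)⁻¹ • (A.cross y (A.cross x j) - A.tb j y • x - ((3 : F)⁻¹ * A.tb x y) • j)

/-- `A` is the split Albert algebra `H₃(Cᵈ, 1)`. -/
def IsSplitAlbert : Prop := A.O.IsSplit ∧ ∀ i, A.γ i = 1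

/-- A point of `H₃(C,γ)` with coordinates `(ε₀,ε₁,ε₂; a,b,c)`. -/
def elt (ε : Fin 3 → F) (a b c : A.O.C) : A.M :=
  Matrix.of
    ![![ε 0 • (1 : A.O.C), c, ((A.γ 0 : F)⁻¹ * (A.γ 2 : F)) • A.O.conj b],
      ![((A.γ 1 : F)⁻¹ * (A.γ 0 : F)) • A.O.conj c, ε 1 • (1 : A.O.C), a],
      ![b, ((A.γ 2 : F)⁻¹ * (A.γ 1 : F)) • A.O.conj a, ε 2 • (1 : A.O.C)]]

/-! ### The Brown algebra `B(J, F×F, ζ)` -/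

/-- Ambient space of the Brown algebra `B(J, F×F, ζ)`: elements `(α, j; j', β)`. -/
abbrev Bam : Type (max u v) := F × A.M × A.M × F

/-- The underlying 56-dimensional space of `B(J, F×F, ζ)`: both middle components lie in `J`. -/
def Bsub : Submodule F A.Bam where
  carrier := {p | p.2.1 ∈ A.J ∧ p.2.2.1 ∈ A.J}
  add_mem' := fun ha hb => ⟨A.J.add_mem ha.1 hb.1, A.J.add_mem ha.2 hb.2⟩
  zero_mem' := ⟨A.J.zero_mem, A.J.zero_mem⟩
  smul_mem' := fun c _ h => ⟨A.J.smul_mem c h.1, A.J.smul_mem c h.2⟩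

/-- The product of `B(J, F×F, ζ)`. -/
def bmul (ζ : F) (x y : A.Bam) : A.Bam :=
  (x.1 * y.1 + ζ * A.tb x.2.1 y.2.2.1,
   x.1 • y.2.1 + y.2.2.2 • x.2.1 + ζ • A.cross x.2.2.1 y.2.2.1,
   y.1 • x.2.2.1 + x.2.2.2 • y.2.2.1 + A.cross x.2.1 y.2.1,
   x.2.2.2 * y.2.2.2 + ζ * A.tb y.2.1 x.2.2.1)

/-- The involution `(α,j;j',β)‾ = (β,j;j',α)` of `B(J, F×F, ζ)`. -/
def binv (x : A.Bam) : A.Bam := (x.2.2.2, x.2.1, x.2.2.1, x.1)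

/-- The skew-symmetric element `s₀ = (1,0;0,−1)`. -/
def s0 : A.Bam := (1, 0, 0, -1)

/-- The triple product `{x,y,z} := (x·ȳ)·z + (z·ȳ)·x − (z·x̄)·y` in `B(J, F×F, ζ)`. -/
def brace (ζ : F) (x y z : A.Bam) : A.Bam :=
  A.bmul ζ (A.bmul ζ x (A.binv y)) z + A.bmul ζ (A.bmul ζ z (A.binv y)) x
    - A.bmul ζ (A.bmul ζ z (A.binv x)) y

/-- The bilinear form of the triple system associated to `B(J, F×F, ζ)` and a skew element
`s`: `b(x,y)` is the unique scalar with `b(x,y)•1 = (x·ȳ − y·x̄)·s`; since the unit of the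
algebra is `(1,0;0,1)`, it is the first component of the right-hand side. -/
def bformS (ζ : F) (s x y : A.Bam) : F :=
  (A.bmul ζ (A.bmul ζ x (A.binv y) - A.bmul ζ y (A.binv x)) s).1

/-- The trilinear product of the triple system associated to `B(J, F×F, ζ)` and `s`:
`t(y,z,w) := 2{y, s·z, w} − b(z,w)·y − b(z,y)·w − b(y,w)·z`. -/
def tformS (ζ : F) (s y z w : A.Bam) : A.Bam :=
  (2 : F) • A.brace ζ y (A.bmul ζ s z) w - A.bformS ζ s z w • y - A.bformS ζ s z y • w
    - A.bformS ζ s y w • z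

/-- The bilinear form of the triple system associated to `B(J, F×F, ζ)` and `s₀`. -/
def bform (ζ : F) (x y : A.Bam) : F := A.bformS ζ A.s0 x y

/-- The trilinear product of the triple system associated to `B(J, F×F, ζ)` and `s₀`. -/
def tform (ζ : F) (y z w : A.Bam) : A.Bam := A.tformS ζ A.s0 y z w

/-- `e` is a singular element of `B(J, F×F, ζ)`: `e ≠ 0` and `U_e(B) ⊆ F·e`
where `U_e(x) := {e,x,e}`. -/
def IsSingular (ζ : F) (e : A.Bam) : Prop :=
  e ≠ 0 ∧ ∀ x ∈ A.Bsub, ∃ c : F, A.brace ζ e x e = c • e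

/-- `I` is an inner ideal of `B(J, F×F, ζ)`: a subspace of `B` with `U_e(B) ⊆ I`
for all `e ∈ I`. -/
def IsInnerIdeal (ζ : F) (I : Submodule F A.Bam) : Prop :=
  I ≤ A.Bsub ∧ ∀ e ∈ I, ∀ x ∈ A.Bsub, A.brace ζ e x e ∈ I

end ReducedAlbert


namespace OctonionAlgebra

variable {F : Type u} [Field F] (O : OctonionAlgebra.{u, v} F)

/-- The polar form `n(x,y)` of the norm of an octonion algebra. -/
def pol (x y : O.C) : F := QuadraticMap.polar (⇑O.n) x y

lemma pol_def (x y : O.C) : O.pol x y = O.n (x + y) - O.n x - O.n y := rfl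

lemma pol_comm (x y : O.C) : O.pol x y = O.pol y x := QuadraticMap.polar_comm _ _ _

@[simp] lemma pol_add_left (x y z : O.C) : O.pol (x + y) z = O.pol x z + O.pol y z :=
  QuadraticMap.polar_add_left _ _ _ _

@[simp] lemma pol_add_right (x y z : O.C) : O.pol x (y + z) = O.pol x y + O.pol x z :=
  QuadraticMap.polar_add_right _ _ _ _

@[simp] lemma pol_sub_left (x y z : O.C) : O.pol (x - y) z = O.pol x z - O.pol y z :=
  QuadraticMap.polar_sub_left _ _ _ _

@[simp] lemma pol_sub_right (x y z : O.C) : O.pol x (y - z) = O.pol x y - O.pol x z :=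
  QuadraticMap.polar_sub_right _ _ _ _

@[simp] lemma pol_smul_left (c : F) (x y : O.C) : O.pol (c • x) y = c * O.pol x y :=
  QuadraticMap.polar_smul_left _ _ _ _

@[simp] lemma pol_smul_right (c : F) (x y : O.C) : O.pol x (c • y) = c * O.pol x y :=
  QuadraticMap.polar_smul_right _ _ _ _

@[simp] lemma pol_zero_left (x : O.C) : O.pol 0 x = 0 := QuadraticMap.polar_zero_left _ _

@[simp] lemma pol_zero_right (x : O.C) : O.pol x 0 = 0 := QuadraticMap.polar_zero_right _ _

lemma n_add (x y : O.C) : O.n (x + y) = O.n x + O.n y + O.pol x y := by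
  rw [pol_def]; ring

lemma pol_self (x : O.C) : O.pol x x = 2 * O.n x := by
  simp [pol]

@[simp] lemma pol_one_one : O.pol 1 1 = 2 := by rw [pol_self, O.n_one, mul_one]

lemma ext_pol {x y : O.C} (h : ∀ z, O.pol x z = O.pol y z) : x = y := by
  refine sub_eq_zero.mp (O.nondeg _ fun z => ?_)
  change O.pol (x - y) z = 0
  rw [pol_sub_left, h, sub_self]

lemma conj_eq (x : O.C) : O.conj x = O.pol x 1 • (1 : O.C) - x := rfl

lemma pol_mul_mul_left (x y z : O.C) : O.pol (x * y) (x * z) = O.n x * O.pol y z := by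
  rw [pol_def, ← mul_add, O.n_mul, O.n_mul, O.n_mul, pol_def]; ring

lemma pol_mul_mul_add (x y z w : O.C) :
    O.pol (x * y) (z * w) + O.pol (x * w) (z * y) = O.pol x z * O.pol y w := by
  have h := O.pol_mul_mul_left (x + z) y w
  simp only [add_mul, pol_add_left, pol_add_right, pol_mul_mul_left, n_add] at h
  rw [O.pol_comm (z * y)] at h
  linear_combination h

lemma pol_mul_left (x y z : O.C) : O.pol (x * y) z = O.pol y (O.conj x * z) := by
  have h := O.pol_mul_mul_add x y 1 z
  rw [one_mul, one_mul, O.pol_comm (x * z)] at h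
  rw [conj_eq, sub_mul, smul_mul_assoc, one_mul, pol_sub_right, pol_smul_right]
  linear_combination h

lemma pol_mul_right (x y z : O.C) : O.pol (x * y) z = O.pol x (z * O.conj y) := by
  have h := O.pol_mul_mul_add x y z 1
  rw [mul_one, mul_one] at h
  rw [conj_eq, mul_sub, mul_smul_comm, mul_one, pol_sub_right, pol_smul_right]
  linear_combination h

@[simp] lemma pol_conj_one (x : O.C) : O.pol (O.conj x) 1 = O.pol x 1 := by
  rw [conj_eq]; simp; ring

@[simp] lemma conj_one : O.conj 1 = 1 := by
  rw [conj_eq, pol_one_one, two_smul, add_sub_cancel_right]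

@[simp] lemma conj_conj (x : O.C) : O.conj (O.conj x) = x := by
  rw [conj_eq, pol_conj_one, conj_eq, sub_sub_cancel]

lemma pol_conj_left (x y : O.C) : O.pol (O.conj x) y = O.pol x (O.conj y) := by
  simp only [conj_eq, pol_sub_left, pol_sub_right, pol_smul_left, pol_smul_right]
  rw [O.pol_comm 1 y]; ring

lemma conj_mul (x y : O.C) : O.conj (x * y) = O.conj y * O.conj x := by
  refine O.ext_pol fun z => ?_
  rw [pol_conj_left, pol_mul_left, O.pol_comm y, pol_mul_right, pol_mul_left (x := O.conj y),
    conj_conj, conj_conj]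

@[simp] lemma n_conj (x : O.C) : O.n (O.conj x) = O.n x := by
  have h : O.pol 1 (-x) = -O.pol x 1 := by
    rw [← neg_one_smul F x, pol_smul_right, O.pol_comm]; ring
  rw [conj_eq, sub_eq_add_neg, n_add, QuadraticMap.map_neg, QuadraticMap.map_smul, O.n_one,
    pol_smul_left, h, smul_eq_mul]
  ring

lemma conj_mul_mul (x y : O.C) : O.conj x * (x * y) = O.n x • y := by
  refine O.ext_pol fun z => ?_
  rw [O.pol_mul_left, conj_conj, pol_mul_mul_left, pol_smul_left]

lemma mul_mul_conj (x y : O.C) : (x * y) * O.conj y = O.n y • x := by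
  have h := congrArg O.conj (O.conj_mul_mul (O.conj y) (O.conj x))
  simpa only [conj_mul, conj_conj, map_smul, n_conj] using h

lemma pol_mul_one_comm (x y : O.C) : O.pol (x * y) 1 = O.pol (y * x) 1 := by
  rw [pol_mul_left, mul_one, pol_mul_right, one_mul]

lemma pol_mul_mul_one (x y z : O.C) : O.pol (x * y * z) 1 = O.pol (x * (y * z)) 1 := by
  rw [pol_mul_right, one_mul, pol_mul_left, O.pol_mul_left x, mul_one, pol_mul_right]

lemma eq_smul_one_of_conj_eq (h2 : (2 : F) ≠ 0) {x : O.C} (h : O.conj x = x) :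
    x = ((2 : F)⁻¹ * O.pol x 1) • (1 : O.C) := by
  rw [conj_eq, sub_eq_iff_eq_add, ← two_smul F x] at h
  rw [mul_smul, h, smul_smul, inv_mul_cancel₀ h2, one_smul]

lemma mul_conj_add (x y : O.C) :
    x * O.conj y + y * O.conj x = O.pol x y • (1 : O.C) := by
  refine O.ext_pol fun z => ?_
  have h := O.pol_mul_mul_add 1 x z y
  rw [one_mul, one_mul] at h
  rw [pol_add_left, pol_smul_left, O.pol_mul_right, O.pol_mul_right y, conj_conj, conj_conj]
  linear_combination h

lemma mul_mul_mul_self (a c : O.C) :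
    a * (c * a) = O.pol c (O.conj a) • a - O.n a • O.conj c := by
  have h := O.conj_mul_mul (O.conj a) (O.conj c)
  rw [conj_conj, n_conj] at h
  have h' := O.mul_conj_add c (O.conj a)
  rw [conj_conj] at h'
  rw [eq_sub_of_add_eq h', mul_sub, h, mul_smul_comm, mul_one]

/-- The middle Moufang identity, with the `U`-operator written out. -/
lemma mul_mul_mul_moufang (a b c : O.C) :
    (a * b) * (c * a) = O.pol a (O.conj (b * c)) • a - O.n a • O.conj (b * c) := by
  refine O.ext_pol fun z => ?_
  have e1 := O.pol_mul_mul_add (a * b) (c * a) z 1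
  have e2 := O.pol_mul_mul_add a b z (c * a)
  rw [mul_mul_mul_self, pol_sub_left, pol_smul_left, pol_smul_left] at e2
  rw [mul_one, mul_one] at e1
  have e3 : O.pol (c * a) 1 = O.pol c (O.conj a) := by rw [pol_mul_right, one_mul]
  have e4 : O.pol (a * b) z + O.pol a (z * b) = O.pol b 1 * O.pol a z := by
    rw [pol_mul_right, conj_eq, mul_sub, mul_smul_comm, mul_one, pol_sub_right, pol_smul_right]
    ring
  have e5 : O.pol (O.conj c) (z * b) = O.pol (O.conj (b * c)) z := by
    rw [O.pol_comm, pol_mul_right, conj_mul, O.pol_comm]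
  have e6 : O.pol b (c * a) + O.pol a (O.conj (b * c)) = O.pol b 1 * O.pol c (O.conj a) := by
    have h : O.pol a (O.conj (b * c)) = O.pol (c * a) (O.conj b) := by
      rw [O.pol_mul_left c, conj_mul]
    rw [h, O.conj_eq b, pol_sub_right, pol_smul_right, e3, O.pol_comm b (c * a)]
    ring
  rw [pol_sub_left, pol_smul_left, pol_smul_left]
  rw [e3] at e1
  rw [e5] at e2
  linear_combination e1 - e2 + O.pol c (O.conj a) * e4 - O.pol a z * e6

lemma pol_conj_mul_rotate (a b c : O.C) :
    O.pol b (O.conj (c * a)) = O.pol a (O.conj (b * c)) := by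
  rw [← pol_conj_left, O.pol_comm, pol_mul_left, conj_mul]

lemma n_smul_sub_smul (s t : F) (x y : O.C) :
    O.n (s • x - t • y) = s ^ 2 * O.n x - s * t * O.pol y x + t ^ 2 * O.n y := by
  rw [sub_eq_add_neg, ← neg_smul, n_add, QuadraticMap.map_smul, QuadraticMap.map_smul,
    pol_smul_left, pol_smul_right, O.pol_comm x y, smul_eq_mul, smul_eq_mul]
  ring

end OctonionAlgebra

namespace ReducedAlbert

variable {F : Type u} [Field F] (A : ReducedAlbert.{u, v} F)

lemma trace_eq (x : A.M) : A.trace x = (2 : F)⁻¹ * ∑ i, A.O.pol (x i i) 1 := rfl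

@[simp] lemma trace_add (x y : A.M) : A.trace (x + y) = A.trace x + A.trace y := by
  simp [trace_eq, Finset.sum_add_distrib, mul_add]

@[simp] lemma trace_smul (c : F) (x : A.M) : A.trace (c • x) = c * A.trace x := by
  simp only [trace_eq, Matrix.smul_apply, OctonionAlgebra.pol_smul_left, ← Finset.mul_sum]
  ring

@[simp] lemma trace_sub (x y : A.M) : A.trace (x - y) = A.trace x - A.trace y := by
  simp [trace_eq, Finset.sum_sub_distrib, mul_sub]

lemma trace_one (h2 : (2 : F) ≠ 0) : A.trace 1 = 3 := by
  simp only [trace_eq, Matrix.one_apply_eq, OctonionAlgebra.pol_one_one]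
  simp only [Finset.sum_const, Finset.card_univ, Fintype.card_fin, nsmul_eq_mul]
  field_simp
  norm_num

lemma trace_mul_comm (x y : A.M) : A.trace (x * y) = A.trace (y * x) := by
  simp only [trace_eq, Matrix.mul_apply, Fin.sum_univ_three, OctonionAlgebra.pol_add_left]
  simp only [A.O.pol_mul_one_comm (x _ _)]
  ring

lemma trace_mul_assoc (x y z : A.M) : A.trace (x * y * z) = A.trace (x * (y * z)) := by
  simp only [trace_eq, Matrix.mul_apply, Fin.sum_univ_three, OctonionAlgebra.pol_add_left, add_mul,
    mul_add, OctonionAlgebra.pol_mul_mul_one]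
  ring

lemma jmul_comm (x y : A.M) : A.jmul x y = A.jmul y x := by
  rw [jmul, jmul, add_comm]

@[simp] lemma jmul_add_left (x y z : A.M) : A.jmul (x + y) z = A.jmul x z + A.jmul y z := by
  simp only [jmul, add_mul, mul_add]; module

@[simp] lemma jmul_smul_left (c : F) (x y : A.M) : A.jmul (c • x) y = c • A.jmul x y := by
  simp only [jmul, smul_mul_assoc, mul_smul_comm]; module

@[simp] lemma jmul_add_right (x y z : A.M) : A.jmul x (y + z) = A.jmul x y + A.jmul x z := by
  rw [jmul_comm, jmul_add_left, jmul_comm, A.jmul_comm z]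

@[simp] lemma jmul_smul_right (c : F) (x y : A.M) : A.jmul x (c • y) = c • A.jmul x y := by
  rw [jmul_comm, jmul_smul_left, jmul_comm]

@[simp] lemma jmul_sub_left (x y z : A.M) : A.jmul (x - y) z = A.jmul x z - A.jmul y z := by
  simp only [jmul, sub_mul, mul_sub]; module

@[simp] lemma jmul_sub_right (x y z : A.M) : A.jmul x (y - z) = A.jmul x y - A.jmul x z := by
  rw [jmul_comm, jmul_sub_left, jmul_comm, A.jmul_comm z]

lemma one_jmul (h2 : (2 : F) ≠ 0) (x : A.M) : A.jmul 1 x = x := by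
  rw [jmul, one_mul, mul_one, ← two_smul F x, smul_smul, inv_mul_cancel₀ h2, one_smul]

lemma tb_comm (x y : A.M) : A.tb x y = A.tb y x := by rw [tb, jmul_comm, tb]

@[simp] lemma tb_add_left (x y z : A.M) : A.tb (x + y) z = A.tb x z + A.tb y z := by simp [tb]

@[simp] lemma tb_smul_left (c : F) (x y : A.M) : A.tb (c • x) y = c * A.tb x y := by simp [tb]

@[simp] lemma tb_sub_left (x y z : A.M) : A.tb (x - y) z = A.tb x z - A.tb y z := by simp [tb]

@[simp] lemma tb_add_right (x y z : A.M) : A.tb x (y + z) = A.tb x y + A.tb x z := by simp [tb]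

@[simp] lemma tb_smul_right (c : F) (x y : A.M) : A.tb x (c • y) = c * A.tb x y := by simp [tb]

@[simp] lemma tb_sub_right (x y z : A.M) : A.tb x (y - z) = A.tb x y - A.tb x z := by simp [tb]

lemma tb_one_left (h2 : (2 : F) ≠ 0) (x : A.M) : A.tb 1 x = A.trace x := by
  rw [tb, one_jmul A h2]

lemma tb_eq_trace_mul (h2 : (2 : F) ≠ 0) (x y : A.M) : A.tb x y = A.trace (x * y) := by
  rw [tb, jmul, trace_smul, trace_add, A.trace_mul_comm y x]
  field_simp
  ring

lemma tb_jmul (x y z : A.M) : A.tb (A.jmul x y) z = A.tb x (A.jmul y z) := by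
  simp only [tb, jmul, smul_mul_assoc, mul_smul_comm, trace_smul, trace_add, add_mul, mul_add,
    trace_mul_assoc]
  rw [A.trace_mul_comm z (x * y), trace_mul_assoc, ← A.trace_mul_assoc y z x,
    A.trace_mul_comm (y * z) x, A.trace_mul_comm z (y * x), trace_mul_assoc,
    ← A.trace_mul_assoc x z y, A.trace_mul_comm (x * z) y]

lemma sharp_one (h2 : (2 : F) ≠ 0) : A.sharp 1 = 1 := by
  rw [sharp, one_jmul A h2, tb_one_left A h2, trace_one A h2]
  have : (2 : F)⁻¹ * (3 ^ 2 - 3) = 3 := by field_simp; norm_num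
  rw [this]; module

lemma sharp_smul (c : F) (x : A.M) : A.sharp (c • x) = c ^ 2 • A.sharp x := by
  simp only [sharp, jmul_smul_left, jmul_smul_right, trace_smul, tb_smul_left, tb_smul_right]
  module

lemma cross_eq (h2 : (2 : F) ≠ 0) (x y : A.M) :
    A.cross x y = (2 : F) • A.jmul x y - A.trace x • y - A.trace y • x
      + (A.trace x * A.trace y - A.tb x y) • (1 : A.M) := by
  have h : A.trace x * A.trace y - A.tb x y
      = (2 : F)⁻¹ * (2 * (A.trace x * A.trace y - A.tb x y)) := by field_simp
  rw [h]
  simp only [cross, sharp, jmul_add_left, jmul_add_right, trace_add, tb_add_left, tb_add_right]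
  rw [A.jmul_comm y x, A.tb_comm y x]
  module

lemma cross_comm (x y : A.M) : A.cross x y = A.cross y x := by
  rw [cross, cross, add_comm x y]; abel

lemma cross_self (x : A.M) : A.cross x x = (2 : F) • A.sharp x := by
  have h : (2 : F) • x = x + x := two_smul F x
  rw [cross, ← h, sharp_smul]; module

lemma sharp_add (x y : A.M) : A.sharp (x + y) = A.sharp x + A.cross x y + A.sharp y := by
  rw [cross]; abel

lemma cross_add_right (h2 : (2 : F) ≠ 0) (x y z : A.M) :
    A.cross x (y + z) = A.cross x y + A.cross x z := by
  simp only [cross_eq A h2, jmul_add_right, trace_add, tb_add_right]; module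

lemma cross_smul_right (h2 : (2 : F) ≠ 0) (c : F) (x y : A.M) :
    A.cross x (c • y) = c • A.cross x y := by
  simp only [cross_eq A h2, jmul_smul_right, trace_smul, tb_smul_right]; module

lemma cross_add_left (h2 : (2 : F) ≠ 0) (x y z : A.M) :
    A.cross (x + y) z = A.cross x z + A.cross y z := by
  rw [cross_comm, cross_add_right A h2, cross_comm, A.cross_comm z]

lemma cross_smul_left (h2 : (2 : F) ≠ 0) (c : F) (x y : A.M) :
    A.cross (c • x) y = c • A.cross x y := by
  rw [cross_comm, cross_smul_right A h2, cross_comm]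

lemma cross_zero_right (h2 : (2 : F) ≠ 0) (x : A.M) : A.cross x 0 = 0 := by
  simpa using A.cross_smul_right h2 0 x 0

lemma cross_zero_left (h2 : (2 : F) ≠ 0) (x : A.M) : A.cross 0 x = 0 := by
  rw [cross_comm, cross_zero_right A h2]

lemma tb_zero_right (x : A.M) : A.tb x 0 = 0 := by
  simpa using A.tb_smul_right 0 x 0

lemma tb_zero_left (x : A.M) : A.tb 0 x = 0 := by
  rw [tb_comm, tb_zero_right]

lemma cross_one_left (h2 : (2 : F) ≠ 0) (x : A.M) :
    A.cross 1 x = A.trace x • (1 : A.M) - x := by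
  rw [cross_eq A h2, one_jmul A h2, tb_one_left A h2, trace_one A h2]; module

lemma tb_cross (h2 : (2 : F) ≠ 0) (x y z : A.M) :
    A.tb (A.cross x y) z = A.tb x (A.cross y z) := by
  simp only [cross_eq A h2, tb_add_left, tb_add_right, tb_sub_left, tb_sub_right, tb_smul_left,
    tb_smul_right, tb_jmul, tb_one_left A h2, A.tb_comm x 1]
  ring

lemma three_mul_norm (h2 : (2 : F) ≠ 0) (h3 : (3 : F) ≠ 0) (x : A.M) :
    3 * A.norm x = A.tb x (A.sharp x) := by
  rw [norm, mul_inv_cancel_left₀ h3,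
    show A.tb x (A.sharp x) = A.trace (A.jmul x (A.sharp x)) from rfl,
    sharp, jmul_add_right,
    jmul_sub_right, jmul_smul_right, jmul_smul_right, A.jmul_comm x 1, one_jmul A h2]

lemma norm_add (h2 : (2 : F) ≠ 0) (h3 : (3 : F) ≠ 0) (x y : A.M) :
    A.norm (x + y) = A.norm x + A.tb (A.sharp x) y + A.tb x (A.sharp y) + A.norm y := by
  have hx : A.tb x (A.cross x y) = 2 * A.tb (A.sharp x) y := by
    rw [← tb_cross A h2, cross_self, tb_smul_left]
  have hy : A.tb y (A.cross x y) = 2 * A.tb x (A.sharp y) := by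
    rw [tb_comm, tb_cross A h2, cross_self, tb_smul_right]
  refine mul_left_cancel₀ h3 ?_
  simp only [mul_add, three_mul_norm A h2 h3, sharp_add, tb_add_left, tb_add_right]
  rw [hx, hy, A.tb_comm y (A.sharp x)]
  ring

lemma norm_smul (h2 : (2 : F) ≠ 0) (h3 : (3 : F) ≠ 0) (c : F) (x : A.M) :
    A.norm (c • x) = c ^ 3 * A.norm x := by
  refine mul_left_cancel₀ h3 ?_
  rw [three_mul_norm A h2 h3, sharp_smul, tb_smul_left, tb_smul_right, ← three_mul_norm A h2 h3]
  ring
lemma jmul_self (h2 : (2 : F) ≠ 0) (x : A.M) : A.jmul x x = x * x := by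
  rw [jmul, ← two_smul F (x * x), smul_smul, inv_mul_cancel₀ h2, one_smul]

lemma elt_mem_J (ε : Fin 3 → F) (a b c : A.O.C) : A.elt ε a b c ∈ A.J := by
  have h0 := (A.γ 0).ne_zero
  have h1 := (A.γ 1).ne_zero
  have h2 := (A.γ 2).ne_zero
  intro i j
  fin_cases i <;> fin_cases j <;>
    simp [elt, smul_smul] <;> field_simp <;> simp

lemma exists_eq_elt (h2 : (2 : F) ≠ 0) {x : A.M} (hx : x ∈ A.J) :
    ∃ ε a b c, x = A.elt ε a b c := by
  have hd (i : Fin 3) : x i i = ((2 : F)⁻¹ * A.O.pol (x i i) 1) • (1 : A.O.C) := by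
    refine A.O.eq_smul_one_of_conj_eq h2 ?_
    have h := hx i i
    rw [inv_mul_cancel₀ (A.γ i).ne_zero, one_smul] at h
    exact h.symm
  refine ⟨fun i => (2 : F)⁻¹ * A.O.pol (x i i) 1, x 1 2, x 2 0, x 0 1, ?_⟩
  ext i j
  fin_cases i <;> fin_cases j
  exacts [hd 0, rfl, hx 0 2, hx 1 0, hd 1, rfl, rfl, hx 2 1, hd 2]

lemma trace_elt (h2 : (2 : F) ≠ 0) (ε : Fin 3 → F) (a b c : A.O.C) :
    A.trace (A.elt ε a b c) = ε 0 + ε 1 + ε 2 := by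
  simp [trace_eq, elt, Fin.sum_univ_three]
  field_simp

lemma tb_elt (h2 : (2 : F) ≠ 0) (ε ε' : Fin 3 → F) (a b c a' b' c' : A.O.C) :
    A.tb (A.elt ε a b c) (A.elt ε' a' b' c') = ε 0 * ε' 0 + ε 1 * ε' 1 + ε 2 * ε' 2
      + (A.γ 2 : F)⁻¹ * A.γ 1 * A.O.pol a a' + (A.γ 0 : F)⁻¹ * A.γ 2 * A.O.pol b b'
      + (A.γ 1 : F)⁻¹ * A.γ 0 * A.O.pol c c' := by
  have h (x y : A.O.C) : A.O.pol (x * A.O.conj y) 1 = A.O.pol x y := by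
    rw [A.O.pol_mul_right, one_mul, A.O.conj_conj]
  have h' (x y : A.O.C) : A.O.pol (A.O.conj x * y) 1 = A.O.pol x y := by
    rw [A.O.pol_mul_one_comm, h, A.O.pol_comm]
  rw [tb_eq_trace_mul A h2]
  simp [trace_eq, elt, Fin.sum_univ_three, mul_smul_comm, h, h']
  field_simp
  ring

lemma sharp_elt (h2 : (2 : F) ≠ 0) (ε : Fin 3 → F) (a b c : A.O.C) :
    A.sharp (A.elt ε a b c) = A.elt
      ![ε 1 * ε 2 - (A.γ 2 : F)⁻¹ * A.γ 1 * A.O.n a,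
        ε 2 * ε 0 - (A.γ 0 : F)⁻¹ * A.γ 2 * A.O.n b,
        ε 0 * ε 1 - (A.γ 1 : F)⁻¹ * A.γ 0 * A.O.n c]
      (((A.γ 1 : F)⁻¹ * A.γ 2) • A.O.conj (b * c) - ε 0 • a)
      (((A.γ 2 : F)⁻¹ * A.γ 0) • A.O.conj (c * a) - ε 1 • b)
      (((A.γ 0 : F)⁻¹ * A.γ 1) • A.O.conj (a * b) - ε 2 • c) := by
  have g0 := (A.γ 0).ne_zero
  have g1 := (A.γ 1).ne_zero
  have g2 := (A.γ 2).ne_zero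
  rw [sharp, jmul_self A h2, tb_elt A h2, trace_elt A h2]
  simp only [A.O.pol_self]
  have hn (x : A.O.C) : x * A.O.conj x = A.O.n x • (1 : A.O.C) := by
    simpa using A.O.mul_mul_conj 1 x
  have hn' (x : A.O.C) : A.O.conj x * x = A.O.n x • (1 : A.O.C) := by
    simpa using A.O.conj_mul_mul x 1
  ext i j
  fin_cases i <;> fin_cases j <;>
    simp [elt, mul_smul_comm, hn, hn',
      A.O.conj_mul, smul_smul, smul_sub] <;>
    match_scalars <;> field_simp <;> ring

lemma norm_elt (h2 : (2 : F) ≠ 0) (h3 : (3 : F) ≠ 0) (ε : Fin 3 → F) (a b c : A.O.C) :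
    A.norm (A.elt ε a b c) = ε 0 * ε 1 * ε 2 - ε 0 * ((A.γ 2 : F)⁻¹ * A.γ 1 * A.O.n a)
      - ε 1 * ((A.γ 0 : F)⁻¹ * A.γ 2 * A.O.n b) - ε 2 * ((A.γ 1 : F)⁻¹ * A.γ 0 * A.O.n c)
      + A.O.pol a (A.O.conj (b * c)) := by
  have g0 := (A.γ 0).ne_zero
  have g1 := (A.γ 1).ne_zero
  have g2 := (A.γ 2).ne_zero
  have hb := A.O.pol_conj_mul_rotate a b c
  have hc := (A.O.pol_conj_mul_rotate b c a).trans hb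
  refine mul_left_cancel₀ h3 ?_
  rw [three_mul_norm A h2 h3, sharp_elt A h2, tb_elt A h2]
  simp [A.O.pol_self, hb, hc]
  field_simp
  ring

lemma sharp_mem_J (h2 : (2 : F) ≠ 0) {x : A.M} (hx : x ∈ A.J) : A.sharp x ∈ A.J := by
  obtain ⟨ε, a, b, c, rfl⟩ := A.exists_eq_elt h2 hx
  rw [sharp_elt A h2]
  exact A.elt_mem_J _ _ _ _

lemma cross_mem_J (h2 : (2 : F) ≠ 0) {x y : A.M} (hx : x ∈ A.J) (hy : y ∈ A.J) :
    A.cross x y ∈ A.J :=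
  A.J.sub_mem (A.J.sub_mem (A.sharp_mem_J h2 (A.J.add_mem hx hy)) (A.sharp_mem_J h2 hx))
    (A.sharp_mem_J h2 hy)

lemma one_mem_J : (1 : A.M) ∈ A.J := by
  intro i j
  by_cases h : i = j
  · subst h; simp
  · simp [h, Ne.symm h]

lemma smul_elt (t : F) (ε : Fin 3 → F) (a b c : A.O.C) :
    t • A.elt ε a b c = A.elt (t • ε) (t • a) (t • b) (t • c) := by
  ext i j
  fin_cases i <;> fin_cases j <;> simp [elt, smul_smul, mul_comm t]

/-- The adjoint identity. -/
lemma sharp_sharp (h2 : (2 : F) ≠ 0) (h3 : (3 : F) ≠ 0) {x : A.M} (hx : x ∈ A.J) :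
    A.sharp (A.sharp x) = A.norm x • x := by
  obtain ⟨ε, a, b, c, rfl⟩ := A.exists_eq_elt h2 hx
  have g0 := (A.γ 0).ne_zero
  have g1 := (A.γ 1).ne_zero
  have g2 := (A.γ 2).ne_zero
  have moufang (a b c : A.O.C) : A.O.conj (A.O.conj (c * a) * A.O.conj (a * b)) =
      A.O.pol a (A.O.conj (b * c)) • a - A.O.n a • A.O.conj (b * c) := by
    rw [A.O.conj_mul, A.O.conj_conj, A.O.conj_conj, A.O.mul_mul_mul_moufang]
  have left (a c : A.O.C) : A.O.conj (A.O.conj (c * a) * c) = A.O.n c • a := by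
    rw [A.O.conj_mul, A.O.conj_conj, A.O.conj_mul_mul]
  have right (a b : A.O.C) : A.O.conj (b * A.O.conj (a * b)) = A.O.n b • a := by
    rw [A.O.conj_mul, A.O.conj_conj, A.O.mul_mul_conj]
  have hb := A.O.pol_conj_mul_rotate a b c
  have hc := (A.O.pol_conj_mul_rotate b c a).trans hb
  rw [sharp_elt A h2, sharp_elt A h2, norm_elt A h2 h3, smul_elt]
  congr 1
  · funext i
    fin_cases i <;> simp [A.O.n_smul_sub_smul, A.O.n_mul, hb, hc] <;> field_simp <;> ring
  all_goals
    simp [mul_sub, sub_mul, mul_smul_comm, smul_mul_assoc, moufang, left, right, hb, hc, smul_sub,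
      smul_smul]
    match_scalars <;> field_simp <;> ring

lemma eq_zero_of_tb (h2 : (2 : F) ≠ 0) {x : A.M} (hx : x ∈ A.J)
    (h : ∀ y ∈ A.J, A.tb x y = 0) : x = 0 := by
  obtain ⟨ε, a, b, c, rfl⟩ := A.exists_eq_elt h2 hx
  have key (ε' a' b' c') := (A.tb_elt h2 ε ε' a b c a' b' c').symm.trans
    (h _ (A.elt_mem_J ε' a' b' c'))
  have ha : a = 0 := A.O.nondeg _ fun z => by simpa [OctonionAlgebra.pol] using key 0 z 0 0
  have hb : b = 0 := A.O.nondeg _ fun z => by simpa [OctonionAlgebra.pol] using key 0 0 z 0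
  have hc : c = 0 := A.O.nondeg _ fun z => by simpa [OctonionAlgebra.pol] using key 0 0 0 z
  have h0 : ε 0 = 0 := by simpa using key ![1, 0, 0] 0 0 0
  have h1 : ε 1 = 0 := by simpa using key ![0, 1, 0] 0 0 0
  have h2 : ε 2 = 0 := by simpa using key ![0, 0, 1] 0 0 0
  ext i j
  fin_cases i <;> fin_cases j <;> simp [elt, ha, hb, hc, h0, h1, h2]

lemma eq_of_tb (h2 : (2 : F) ≠ 0) {x y : A.M} (hx : x ∈ A.J) (hy : y ∈ A.J)
    (h : ∀ z ∈ A.J, A.tb x z = A.tb y z) : x = y :=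
  sub_eq_zero.mp <| A.eq_zero_of_tb h2 (A.J.sub_mem hx hy) fun z hz => by
    rw [tb_sub_left, h z hz, sub_self]

section NormSimilarity

variable {A} {B : ReducedAlbert.{u, v} F} {φ : A.M →ₗ[F] B.M} {μ : F}

lemma tb_sharp_of_norm (h2 : (2 : F) ≠ 0) (h3 : (3 : F) ≠ 0)
    (hN : ∀ j ∈ A.J, B.norm (φ j) = μ * A.norm j) {x y : A.M} (hx : x ∈ A.J) (hy : y ∈ A.J) :
    B.tb (B.sharp (φ x)) (φ y) = μ * A.tb (A.sharp x) y := by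
  have key (t : F) (ht : t ^ 2 = 1) :
      t * B.tb (B.sharp (φ x)) (φ y) + B.tb (φ x) (B.sharp (φ y))
        = μ * (t * A.tb (A.sharp x) y + A.tb x (A.sharp y)) := by
    have h := hN (x + t • y) (A.J.add_mem hx (A.J.smul_mem t hy))
    rw [map_add, map_smul, norm_add B h2 h3, norm_add A h2 h3, norm_smul B h2 h3,
      norm_smul A h2 h3, hN x hx, hN y hy, sharp_smul, sharp_smul, ht, one_smul, one_smul,
      tb_smul_right, tb_smul_right] at h
    linear_combination h
  refine mul_left_cancel₀ h2 ?_
  linear_combination key 1 (by ring) - key (-1) (by ring)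

variable (φ μ) in
/-- The contragredient of a norm similarity `φ` with multiplier `μ`. -/
def contragredient (h2 : (2 : F) ≠ 0) : A.M →ₗ[F] B.M where
  toFun y := μ⁻¹ • (A.trace y • B.sharp (φ 1) - B.cross (φ 1) (φ y))
  map_add' x y := by
    rw [map_add, trace_add, cross_add_right B h2]; module
  map_smul' c x := by
    rw [map_smul, trace_smul, cross_smul_right B h2, RingHom.id_apply]; module

lemma contragredient_apply (h2 : (2 : F) ≠ 0) (y : A.M) :
    contragredient φ μ h2 y = μ⁻¹ • (A.trace y • B.sharp (φ 1) - B.cross (φ 1) (φ y)) := rfl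

lemma tb_cross_of_norm (h2 : (2 : F) ≠ 0) (h3 : (3 : F) ≠ 0)
    (hN : ∀ j ∈ A.J, B.norm (φ j) = μ * A.norm j) {x y z : A.M} (hx : x ∈ A.J) (hy : y ∈ A.J)
    (hz : z ∈ A.J) : B.tb (B.cross (φ x) (φ y)) (φ z) = μ * A.tb (A.cross x y) z := by
  rw [cross, cross, ← map_add]
  simp only [tb_sub_left]
  rw [tb_sharp_of_norm h2 h3 hN (A.J.add_mem hx hy) hz, tb_sharp_of_norm h2 h3 hN hx hz,
    tb_sharp_of_norm h2 h3 hN hy hz]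
  ring

lemma tb_contragredient (h2 : (2 : F) ≠ 0) (h3 : (3 : F) ≠ 0) (hμ : μ ≠ 0)
    (hN : ∀ j ∈ A.J, B.norm (φ j) = μ * A.norm j) {y z : A.M} (hy : y ∈ A.J) (hz : z ∈ A.J) :
    B.tb (contragredient φ μ h2 y) (φ z) = A.tb y z := by
  rw [contragredient_apply, tb_smul_left, tb_sub_left, tb_smul_left,
    tb_sharp_of_norm h2 h3 hN A.one_mem_J hz, tb_cross_of_norm h2 h3 hN A.one_mem_J hy hz,
    cross_one_left A h2, sharp_one A h2, tb_sub_left, tb_smul_left]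
  field_simp
  ring

lemma contragredient_mem_J (h2 : (2 : F) ≠ 0) (hφ : Set.MapsTo φ A.J B.J) {y : A.M}
    (hy : y ∈ A.J) : contragredient φ μ h2 y ∈ B.J :=
  B.J.smul_mem _ <| B.J.sub_mem (B.J.smul_mem _ (B.sharp_mem_J h2 (hφ A.one_mem_J)))
    (B.cross_mem_J h2 (hφ A.one_mem_J) (hφ hy))

lemma contragredient_sharp (h2 : (2 : F) ≠ 0) (h3 : (3 : F) ≠ 0) (hμ : μ ≠ 0)
    (hφ : Set.BijOn φ A.J B.J) (hN : ∀ j ∈ A.J, B.norm (φ j) = μ * A.norm j)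
    {x : A.M} (hx : x ∈ A.J) :
    contragredient φ μ h2 (A.sharp x) = μ⁻¹ • B.sharp (φ x) := by
  refine B.eq_of_tb h2 (contragredient_mem_J h2 hφ.mapsTo (A.sharp_mem_J h2 hx))
    (B.J.smul_mem _ (B.sharp_mem_J h2 (hφ.mapsTo hx))) fun w hw => ?_
  obtain ⟨z, hz, rfl⟩ := hφ.surjOn hw
  rw [tb_contragredient h2 h3 hμ hN (A.sharp_mem_J h2 hx) hz, tb_smul_left,
    tb_sharp_of_norm h2 h3 hN hx hz, inv_mul_cancel_left₀ hμ]

lemma contragredient_cross (h2 : (2 : F) ≠ 0) (h3 : (3 : F) ≠ 0) (hμ : μ ≠ 0)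
    (hφ : Set.BijOn φ A.J B.J) (hN : ∀ j ∈ A.J, B.norm (φ j) = μ * A.norm j)
    {x y : A.M} (hx : x ∈ A.J) (hy : y ∈ A.J) :
    contragredient φ μ h2 (A.cross x y) = μ⁻¹ • B.cross (φ x) (φ y) := by
  rw [cross, cross, map_sub, map_sub, contragredient_sharp h2 h3 hμ hφ hN (A.J.add_mem hx hy),
    contragredient_sharp h2 h3 hμ hφ hN hx, contragredient_sharp h2 h3 hμ hφ hN hy, map_add,
    smul_sub, smul_sub]

/-- The adjoint of the contragredient. The identity holds on adjoints by the adjoint identity,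
and extends to all of `J` by expanding it at `(1 + t • x)^#`. -/
lemma sharp_contragredient (h2 : (2 : F) ≠ 0) (h3 : (3 : F) ≠ 0) (hμ : μ ≠ 0)
    (hφ : Set.BijOn φ A.J B.J) (hN : ∀ j ∈ A.J, B.norm (φ j) = μ * A.norm j)
    {x : A.M} (hx : x ∈ A.J) :
    B.sharp (contragredient φ μ h2 x) = μ⁻¹ • φ (A.sharp x) := by
  set ψ := contragredient (B := B) φ μ h2 with hψ
  let E (y : A.M) : B.M := B.sharp (ψ y) - μ⁻¹ • φ (A.sharp y)
  let D (y z : A.M) : B.M := B.cross (ψ y) (ψ z) - μ⁻¹ • φ (A.cross y z)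
  have E_add (y z : A.M) : E (y + z) = E y + D y z + E z := by
    simp only [E, D, map_add, sharp_add, smul_add]; abel
  have E_smul (c : F) (y : A.M) : E (c • y) = c ^ 2 • E y := by
    simp only [E, map_smul, sharp_smul]; module
  have D_add_left (y y' z : A.M) : D (y + y') z = D y z + D y' z := by
    simp only [D, map_add, cross_add_left B h2, cross_add_left A h2]; module
  have D_smul_left (c : F) (y z : A.M) : D (c • y) z = c • D y z := by
    simp only [D, map_smul, cross_smul_left B h2, cross_smul_left A h2]; module
  have D_smul_right (c : F) (y z : A.M) : D y (c • z) = c • D y z := by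
    simp only [D, map_smul, cross_smul_right B h2, cross_smul_right A h2]; module
  have D_add_right (y z z' : A.M) : D y (z + z') = D y z + D y z' := by
    simp only [D, map_add, cross_add_right B h2, cross_add_right A h2]; module
  have D_self (y : A.M) : D y y = (2 : F) • E y := by
    simp only [D, E, cross_self, map_smul]; module
  have E_sharp (y : A.M) (hy : y ∈ A.J) : E (A.sharp y) = 0 := by
    simp only [E, hψ]
    rw [contragredient_sharp h2 h3 hμ hφ hN hy, sharp_smul, sharp_sharp B h2 h3 (hφ.mapsTo hy),
      sharp_sharp A h2 h3 hy, hN y hy, map_smul, smul_smul, smul_smul, sub_eq_zero]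
    congr 1
    field_simp
  have E_one : E 1 = 0 := by
    simpa only [sharp_one A h2] using E_sharp 1 A.one_mem_J
  have expand (y : A.M) (hy : y ∈ A.J) (t : F) :
      t • D 1 (A.cross 1 y) + t ^ 2 • (D 1 (A.sharp y) + E (A.cross 1 y))
        + t ^ 3 • D (A.cross 1 y) (A.sharp y) = 0 := by
    have h := E_sharp (1 + t • y) (A.J.add_mem A.one_mem_J (A.J.smul_mem t hy))
    rw [sharp_add, sharp_one A h2, cross_smul_right A h2, sharp_smul, E_add, E_add, E_smul, E_smul,
      E_one, E_sharp y hy, D_add_left, D_smul_left, D_smul_right, D_smul_right, D_smul_right] at h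
    rw [← h]
    module
  have hsix : (6 : F) ≠ 0 := by
    rw [show (6 : F) = 2 * 3 by norm_num]
    exact mul_ne_zero h2 h3
  have D_one_cross (y : A.M) (hy : y ∈ A.J) : D 1 (A.cross 1 y) = 0 := by
    refine (smul_eq_zero_iff_right hsix).mp ?_
    linear_combination (norm := module) (6 : F) • expand y hy 1 - (2 : F) • expand y hy (-1)
      - expand y hy 2
  have E_cross (y : A.M) (hy : y ∈ A.J) : D 1 (A.sharp y) + E (A.cross 1 y) = 0 := by
    refine (smul_eq_zero_iff_right h2).mp ?_
    linear_combination (norm := module) expand y hy 1 + expand y hy (-1)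
  have D_one (y : A.M) (hy : y ∈ A.J) : D 1 y = 0 := by
    have h := D_one_cross y hy
    rw [cross_one_left A h2, sub_eq_add_neg, ← neg_one_smul F y, D_add_right, D_smul_right,
      D_smul_right, D_self, E_one] at h
    simpa using h
  have h := E_cross x hx
  rw [D_one _ (A.sharp_mem_J h2 hx), cross_one_left A h2, sub_eq_add_neg, ← neg_one_smul F x,
    E_add, E_smul, E_smul, E_one, D_smul_left, D_smul_right, D_one x hx] at h
  exact sub_eq_zero.mp (by simpa using h)

lemma cross_contragredient (h2 : (2 : F) ≠ 0) (h3 : (3 : F) ≠ 0) (hμ : μ ≠ 0)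
    (hφ : Set.BijOn φ A.J B.J) (hN : ∀ j ∈ A.J, B.norm (φ j) = μ * A.norm j)
    {x y : A.M} (hx : x ∈ A.J) (hy : y ∈ A.J) :
    B.cross (contragredient φ μ h2 x) (contragredient φ μ h2 y) = μ⁻¹ • φ (A.cross x y) := by
  rw [cross, cross, ← map_add, sharp_contragredient h2 h3 hμ hφ hN (A.J.add_mem hx hy),
    sharp_contragredient h2 h3 hμ hφ hN hx, sharp_contragredient h2 h3 hμ hφ hN hy, map_sub,
    map_sub, smul_sub, smul_sub]

lemma bijOn_contragredient (h2 : (2 : F) ≠ 0) (h3 : (3 : F) ≠ 0) (hμ : μ ≠ 0)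
    (hφ : Set.BijOn φ A.J B.J) (hN : ∀ j ∈ A.J, B.norm (φ j) = μ * A.norm j) :
    Set.BijOn (contragredient (B := B) φ μ h2) A.J B.J := by
  refine ⟨fun y hy => contragredient_mem_J h2 hφ.mapsTo hy, fun x hx y hy h => ?_, fun k hk => ?_⟩
  · refine A.eq_of_tb h2 hx hy fun z hz => ?_
    rw [← tb_contragredient h2 h3 hμ hN hx hz, h, tb_contragredient h2 h3 hμ hN hy hz]
  · obtain ⟨e, he, he'⟩ := hφ.surjOn B.one_mem_J
    obtain ⟨w, hw, hw'⟩ := hφ.surjOn (B.cross_mem_J h2 B.one_mem_J hk)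
    refine ⟨μ • (A.cross e w - B.trace k • A.sharp e), A.J.smul_mem _ (A.J.sub_mem
      (A.cross_mem_J h2 he hw) (A.J.smul_mem _ (A.sharp_mem_J h2 he))), ?_⟩
    rw [map_smul, map_sub, map_smul, contragredient_cross h2 h3 hμ hφ hN he hw,
      contragredient_sharp h2 h3 hμ hφ hN he, he', hw', sharp_one B h2, cross_one_left B h2,
      cross_one_left B h2, trace_sub, trace_smul, trace_one B h2]
    match_scalars <;> field_simp
    ring

end NormSimilarity

/-- An isomorphism `B(A, F×F, ζ₁) → B(B, F×F, ζ₂)` of algebras with involution. -/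
def IsBrownIso {A B : ReducedAlbert.{u, v} F} (ζ₁ ζ₂ : F) (f : A.Bam →ₗ[F] B.Bam) : Prop :=
  Set.BijOn f (A.Bsub : Set A.Bam) (B.Bsub : Set B.Bam) ∧
    (∀ x ∈ A.Bsub, ∀ y ∈ A.Bsub, f (A.bmul ζ₁ x y) = B.bmul ζ₂ (f x) (f y)) ∧
    (∀ x ∈ A.Bsub, f (A.binv x) = B.binv (f x))

variable {A} {B : ReducedAlbert.{u, v} F} {ζ₁ ζ₂ : F}

lemma exists_isBrownIso_of_norm_div (h2 : (2 : F) ≠ 0) (h3 : (3 : F) ≠ 0) (hζ₁ : ζ₁ ≠ 0)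
    (hζ₂ : ζ₂ ≠ 0) {φ : A.M →ₗ[F] B.M} (hφ : Set.BijOn φ A.J B.J)
    (hN : ∀ j ∈ A.J, B.norm (φ j) = ζ₁ / ζ₂ * A.norm j) :
    ∃ f : A.Bam →ₗ[F] B.Bam, IsBrownIso ζ₁ ζ₂ f := by
  have hμ : ζ₁ / ζ₂ ≠ 0 := div_ne_zero hζ₁ hζ₂
  set μ := ζ₁ / ζ₂ with hμ'
  have hψ := bijOn_contragredient h2 h3 hμ hφ hN
  have hψψ {x y : A.M} (hx : x ∈ A.J) (hy : y ∈ A.J) := cross_contragredient h2 h3 hμ hφ hN hx hy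
  have hφφ {x y : A.M} (hx : x ∈ A.J) (hy : y ∈ A.J) := contragredient_cross h2 h3 hμ hφ hN hx hy
  have htb {x y : A.M} (hx : x ∈ A.J) (hy : y ∈ A.J) := tb_contragredient h2 h3 hμ hN hx hy
  set ψ := contragredient (B := B) φ μ h2
  refine ⟨LinearMap.id.prodMap (φ.prodMap ((μ • ψ).prodMap LinearMap.id)), ⟨?_, ?_, ?_⟩, ?_, ?_⟩
  · rintro ⟨α, j, j', β⟩ ⟨hj, hj'⟩
    exact ⟨hφ.mapsTo hj, B.J.smul_mem _ (hψ.mapsTo hj')⟩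
  · rintro ⟨α, j, j', β⟩ ⟨hj, hj'⟩ ⟨α₂, k, k', β₂⟩ ⟨hk, hk'⟩ h
    simp only [LinearMap.prodMap_apply, LinearMap.id_apply, LinearMap.smul_apply,
      Prod.mk.injEq, smul_right_inj hμ] at h
    simp only at hj hj' hk hk'
    rw [h.1, h.2.2.2, hφ.injOn hj hk h.2.1, hψ.injOn hj' hk' h.2.2.1]
  · rintro ⟨α, j, j', β⟩ ⟨hj, hj'⟩
    obtain ⟨k, hk, rfl⟩ := hφ.surjOn hj
    obtain ⟨k', hk', hkk⟩ := hψ.surjOn (B.J.smul_mem μ⁻¹ hj')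
    refine ⟨(α, k, k', β), ⟨hk, hk'⟩, ?_⟩
    simp [hkk, smul_smul, hμ]
  · rintro ⟨α, j, j', β⟩ ⟨hj, hj'⟩ ⟨α₂, k, k', β₂⟩ ⟨hk, hk'⟩
    simp only at hj hj' hk hk'
    have e₁ : B.tb (φ j) (ψ k') = A.tb j k' := by rw [tb_comm, htb hk' hj, tb_comm]
    have e₂ : B.tb (φ k) (ψ j') = A.tb k j' := by rw [tb_comm, htb hj' hk, tb_comm]
    have hz : ζ₂ * μ = ζ₁ := by rw [hμ']; field_simp
    simp only [bmul, LinearMap.prodMap_apply, LinearMap.id_apply, LinearMap.smul_apply, map_add,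
      map_smul, tb_smul_right, cross_smul_left B h2, cross_smul_right B h2, hψψ hj' hk',
      hφφ hj hk, e₁, e₂, ← hz]
    refine Prod.ext ?_ (Prod.ext ?_ (Prod.ext ?_ ?_)) <;> dsimp only
    · ring
    · match_scalars <;> field_simp
    · match_scalars <;> field_simp
    · ring
  · rintro ⟨α, j, j', β⟩ -
    rfl

lemma exists_isBrownIso_of_norm_div_sq (h2 : (2 : F) ≠ 0) (h3 : (3 : F) ≠ 0) (hζ₁ : ζ₁ ≠ 0)
    (hζ₂ : ζ₂ ≠ 0) {φ : A.M →ₗ[F] B.M} (hφ : Set.BijOn φ A.J B.J)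
    (hN : ∀ j ∈ A.J, B.norm (φ j) = ζ₁ / ζ₂ ^ 2 * A.norm j) :
    ∃ f : A.Bam →ₗ[F] B.Bam, IsBrownIso ζ₁ ζ₂ f := by
  have hμ : ζ₁ / ζ₂ ^ 2 ≠ 0 := div_ne_zero hζ₁ (pow_ne_zero 2 hζ₂)
  have hν : ζ₁ / ζ₂ ≠ 0 := div_ne_zero hζ₁ hζ₂
  set μ := ζ₁ / ζ₂ ^ 2 with hμ'
  set ν := ζ₁ / ζ₂ with hν'
  have hψ := bijOn_contragredient h2 h3 hμ hφ hN
  have hψψ {x y : A.M} (hx : x ∈ A.J) (hy : y ∈ A.J) := cross_contragredient h2 h3 hμ hφ hN hx hy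
  have hφφ {x y : A.M} (hx : x ∈ A.J) (hy : y ∈ A.J) := contragredient_cross h2 h3 hμ hφ hN hx hy
  have htb {x y : A.M} (hx : x ∈ A.J) (hy : y ∈ A.J) := tb_contragredient h2 h3 hμ hN hx hy
  set ψ := contragredient (B := B) φ μ h2
  let f : A.Bam →ₗ[F] B.Bam :=
    { toFun := fun x => (x.2.2.2, ν • ψ x.2.2.1, φ x.2.1, x.1)
      map_add' := fun x y => by simp
      map_smul' := fun c x => by simp [smul_comm c ν] }
  have hf (x : A.Bam) : f x = (x.2.2.2, ν • ψ x.2.2.1, φ x.2.1, x.1) := rfl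
  refine ⟨f, ⟨?_, ?_, ?_⟩, ?_, ?_⟩
  · rintro ⟨α, j, j', β⟩ ⟨hj, hj'⟩
    exact ⟨B.J.smul_mem _ (hψ.mapsTo hj'), hφ.mapsTo hj⟩
  · rintro ⟨α, j, j', β⟩ ⟨hj, hj'⟩ ⟨α₂, k, k', β₂⟩ ⟨hk, hk'⟩ h
    simp only [hf, Prod.mk.injEq, smul_right_inj hν] at h
    simp only at hj hj' hk hk'
    rw [h.1, h.2.2.2, hφ.injOn hj hk h.2.2.1, hψ.injOn hj' hk' h.2.1]
  · rintro ⟨α, j, j', β⟩ ⟨hj, hj'⟩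
    obtain ⟨k, hk, rfl⟩ := hφ.surjOn hj'
    obtain ⟨k', hk', hkk⟩ := hψ.surjOn (B.J.smul_mem ν⁻¹ hj)
    refine ⟨(β, k, k', α), ⟨hk, hk'⟩, ?_⟩
    simp [hf, hkk, smul_smul, hν]
  · rintro ⟨α, j, j', β⟩ ⟨hj, hj'⟩ ⟨α₂, k, k', β₂⟩ ⟨hk, hk'⟩
    simp only at hj hj' hk hk'
    have hz : ζ₂ * ν = ζ₁ := by rw [hν']; field_simp
    have hw : ζ₂ * μ = ν := by rw [hμ', hν']; field_simp
    simp only [bmul, hf, map_add, map_smul, tb_smul_left, cross_smul_left B h2,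
      cross_smul_right B h2, hψψ hj' hk', hφφ hj hk, htb hk' hj, htb hj' hk, A.tb_comm j,
      A.tb_comm k, ← hz, ← hw]
    refine Prod.ext ?_ (Prod.ext ?_ (Prod.ext ?_ ?_)) <;> dsimp only
    · ring
    · match_scalars <;> field_simp
    · match_scalars <;> field_simp
    · ring
  · rintro ⟨α, j, j', β⟩ -
    rfl

lemma bmul_diag_left (h2 : (2 : F) ≠ 0) (ζ c d : F) (x : A.Bam) :
    A.bmul ζ (c, 0, 0, d) x = (c * x.1, c • x.2.1, d • x.2.2.1, d * x.2.2.2) := by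
  simp [bmul, tb_zero_left, tb_zero_right, cross_zero_left A h2]

lemma bmul_diag_right (h2 : (2 : F) ≠ 0) (ζ c d : F) (x : A.Bam) :
    A.bmul ζ x (c, 0, 0, d) = (x.1 * c, d • x.2.1, c • x.2.2.1, x.2.2.2 * d) := by
  simp [bmul, tb_zero_left, tb_zero_right, cross_zero_right A h2]

lemma bmul_inl_inr (h2 : (2 : F) ≠ 0) (ζ : F) (j j' : A.M) :
    A.bmul ζ (0, j, 0, 0) (0, 0, j', 0) = (ζ * A.tb j j', 0, 0, 0) := by
  simp [bmul, tb_zero_left, cross_zero_left A h2, cross_zero_right A h2]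

lemma bmul_inr_inl (h2 : (2 : F) ≠ 0) (ζ : F) (j j' : A.M) :
    A.bmul ζ (0, 0, j', 0) (0, j, 0, 0) = (0, 0, 0, ζ * A.tb j j') := by
  simp [bmul, tb_zero_left, cross_zero_left A h2, cross_zero_right A h2]

lemma bmul_inl_inl (h2 : (2 : F) ≠ 0) (ζ : F) (j k : A.M) :
    A.bmul ζ (0, j, 0, 0) (0, k, 0, 0) = (0, 0, A.cross j k, 0) := by
  simp [bmul, tb_zero_right, cross_zero_left A h2]

lemma bmul_inr_inr (h2 : (2 : F) ≠ 0) (ζ : F) (j k : A.M) :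
    A.bmul ζ (0, 0, j, 0) (0, 0, k, 0) = (0, ζ • A.cross j k, 0, 0) := by
  simp [bmul, tb_zero_left, cross_zero_left A h2]

lemma eq_zero_of_neg_eq (h2 : (2 : F) ≠ 0) {V : Type*} [AddCommGroup V] [Module F V] {x : V}
    (h : -x = x) : x = 0 := by
  refine (smul_eq_zero_iff_right h2).mp ?_
  rw [two_smul]
  nth_rewrite 1 [← h]
  exact neg_add_cancel x

/-- The component `(0, J; 0, 0)` is an eigenspace for the multiplications by `s₀`. -/
lemma eq_inl_iff (h2 : (2 : F) ≠ 0) (ζ : F) {x : A.Bam} :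
    x = (0, x.2.1, 0, 0) ↔ A.bmul ζ A.s0 x = x ∧ A.bmul ζ x A.s0 = -x := by
  obtain ⟨α, j, j', β⟩ := x
  rw [s0, bmul_diag_left h2, bmul_diag_right h2]
  simp only [Prod.neg_mk, Prod.mk.injEq, one_smul, neg_smul, one_mul, mul_one, neg_mul, mul_neg,
    true_and, and_true]
  constructor
  · rintro ⟨rfl, rfl, rfl⟩
    simp
  · rintro ⟨⟨hj, hβ⟩, hα, -⟩
    exact ⟨eq_zero_of_neg_eq h2 hα.symm, eq_zero_of_neg_eq h2 hj, eq_zero_of_neg_eq h2 hβ⟩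

/-- The component `(0, 0; J, 0)` is an eigenspace for the multiplications by `s₀`. -/
lemma eq_inr_iff (h2 : (2 : F) ≠ 0) (ζ : F) {x : A.Bam} :
    x = (0, 0, x.2.2.1, 0) ↔ A.bmul ζ A.s0 x = -x ∧ A.bmul ζ x A.s0 = x := by
  obtain ⟨α, j, j', β⟩ := x
  rw [s0, bmul_diag_left h2, bmul_diag_right h2]
  simp only [Prod.neg_mk, Prod.mk.injEq, one_smul, neg_smul, one_mul, mul_one, neg_mul, mul_neg,
    true_and, and_true]
  constructor
  · rintro ⟨rfl, rfl, rfl⟩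
    simp
  · rintro ⟨⟨hα, hj⟩, -, hβ⟩
    exact ⟨eq_zero_of_neg_eq h2 hα.symm, eq_zero_of_neg_eq h2 hj.symm, eq_zero_of_neg_eq h2 hβ⟩

lemma bmul_neg_left (h2 : (2 : F) ≠ 0) (ζ : F) (x : A.Bam) :
    A.bmul ζ (-A.s0) x = -A.bmul ζ A.s0 x := by
  simp [s0, bmul_diag_left h2]

lemma bmul_neg_right (h2 : (2 : F) ≠ 0) (ζ : F) (x : A.Bam) :
    A.bmul ζ x (-A.s0) = -A.bmul ζ x A.s0 := by
  simp [s0, bmul_diag_right h2]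

lemma diag_mem_Bsub (c d : F) : ((c, 0, 0, d) : A.Bam) ∈ A.Bsub :=
  ⟨A.J.zero_mem, A.J.zero_mem⟩

lemma inl_mem_Bsub {j : A.M} (hj : j ∈ A.J) : ((0, j, 0, 0) : A.Bam) ∈ A.Bsub :=
  ⟨hj, A.J.zero_mem⟩

lemma inr_mem_Bsub {j : A.M} (hj : j ∈ A.J) : ((0, 0, j, 0) : A.Bam) ∈ A.Bsub :=
  ⟨A.J.zero_mem, hj⟩

lemma norm_of_tb_of_cross (h2 : (2 : F) ≠ 0) (h3 : (3 : F) ≠ 0) {φ ψ : A.M →ₗ[F] B.M} {κ ν : F}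
    (htb : ∀ j ∈ A.J, ∀ k ∈ A.J, B.tb (φ j) (ψ k) = ν * A.tb j k)
    (hcross : ∀ j ∈ A.J, B.cross (φ j) (φ j) = κ • ψ (A.cross j j)) {j : A.M} (hj : j ∈ A.J) :
    B.norm (φ j) = κ * ν * A.norm j := by
  have h : B.sharp (φ j) = κ • ψ (A.sharp j) := by
    have := hcross j hj
    rw [cross_self, cross_self, map_smul, smul_comm κ] at this
    exact smul_right_injective _ h2 this
  refine mul_left_cancel₀ h3 ?_
  rw [three_mul_norm B h2 h3, h, tb_smul_right, htb j hj _ (A.sharp_mem_J h2 hj)]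
  linear_combination (-κ * ν) * three_mul_norm A h2 h3 j

namespace IsBrownIso

variable {f : A.Bam →ₗ[F] B.Bam}

lemma map_one (h2 : (2 : F) ≠ 0) (hf : IsBrownIso ζ₁ ζ₂ f) : f (1, 0, 0, 1) = (1, 0, 0, 1) := by
  obtain ⟨u, hu, hu'⟩ := hf.1.surjOn (diag_mem_Bsub (A := B) 1 1)
  have h := hf.2.1 _ (diag_mem_Bsub 1 1) u hu
  rw [hu', bmul_diag_left h2, bmul_diag_right h2] at h
  simp only [one_mul, mul_one, one_smul] at h
  exact h.symm.trans hu'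

lemma map_s0 (h2 : (2 : F) ≠ 0) (hf : IsBrownIso ζ₁ ζ₂ f) : f A.s0 = B.s0 ∨ f A.s0 = -B.s0 := by
  have hs : A.s0 ∈ A.Bsub := diag_mem_Bsub 1 (-1)
  have hinv : A.binv A.s0 = -A.s0 := by simp [s0, binv]
  have hskew := hf.2.2 _ hs
  rw [hinv, map_neg] at hskew
  obtain ⟨c, hc⟩ : ∃ c : F, f A.s0 = (c, 0, 0, -c) := by
    rcases hx : f A.s0 with ⟨α, j, j', β⟩
    simp only [hx, binv, Prod.neg_mk, Prod.mk.injEq] at hskew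
    exact ⟨α, by rw [eq_zero_of_neg_eq h2 hskew.2.1, eq_zero_of_neg_eq h2 hskew.2.2.1, hskew.1]⟩
  have hsq : A.bmul ζ₁ A.s0 A.s0 = (1, 0, 0, 1) := by simp [s0, bmul_diag_left h2]
  have h := hf.2.1 _ hs _ hs
  rw [hsq, hf.map_one h2, hc, bmul_diag_left h2] at h
  rcases mul_self_eq_one_iff.mp (congrArg Prod.fst h).symm with rfl | rfl
  · exact .inl hc
  · exact .inr (by rw [hc]; simp [s0])

lemma eq_iff (hf : IsBrownIso ζ₁ ζ₂ f) {x y : A.Bam} (hx : x ∈ A.Bsub) (hy : y ∈ A.Bsub) :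
    f x = f y ↔ x = y := hf.1.injOn.eq_iff hx hy

lemma bmul_mem_Bsub (h2 : (2 : F) ≠ 0) (ζ : F) {x y : A.Bam} (hx : x ∈ A.Bsub)
    (hy : y ∈ A.Bsub) : A.bmul ζ x y ∈ A.Bsub :=
  ⟨A.J.add_mem (A.J.add_mem (A.J.smul_mem _ hy.1) (A.J.smul_mem _ hx.1))
      (A.J.smul_mem _ (A.cross_mem_J h2 hx.2 hy.2)),
    A.J.add_mem (A.J.add_mem (A.J.smul_mem _ hx.2) (A.J.smul_mem _ hy.2))
      (A.cross_mem_J h2 hx.1 hy.1)⟩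

lemma s0_mem_Bsub : A.s0 ∈ A.Bsub := diag_mem_Bsub 1 (-1)

section

variable (h2 : (2 : F) ≠ 0) (hf : IsBrownIso ζ₁ ζ₂ f) {x : A.Bam} (hx : x ∈ A.Bsub)
include h2 hf hx

lemma eq_inl_iff_of_pos (hs : f A.s0 = B.s0) :
    f x = (0, (f x).2.1, 0, 0) ↔ x = (0, x.2.1, 0, 0) := by
  rw [eq_inl_iff (A := A) h2 ζ₁, eq_inl_iff (A := B) h2 ζ₂, ← hs, ← hf.2.1 _ s0_mem_Bsub _ hx,
    ← hf.2.1 _ hx _ s0_mem_Bsub, ← map_neg, hf.eq_iff (bmul_mem_Bsub h2 _ s0_mem_Bsub hx) hx,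
    hf.eq_iff (bmul_mem_Bsub h2 _ hx s0_mem_Bsub) (neg_mem hx)]

lemma eq_inr_iff_of_pos (hs : f A.s0 = B.s0) :
    f x = (0, 0, (f x).2.2.1, 0) ↔ x = (0, 0, x.2.2.1, 0) := by
  rw [eq_inr_iff (A := A) h2 ζ₁, eq_inr_iff (A := B) h2 ζ₂, ← hs, ← hf.2.1 _ s0_mem_Bsub _ hx,
    ← hf.2.1 _ hx _ s0_mem_Bsub, ← map_neg, hf.eq_iff (bmul_mem_Bsub h2 _ hx s0_mem_Bsub) hx,
    hf.eq_iff (bmul_mem_Bsub h2 _ s0_mem_Bsub hx) (neg_mem hx)]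

lemma eq_inr_iff_of_neg (hs : f A.s0 = -B.s0) :
    f x = (0, 0, (f x).2.2.1, 0) ↔ x = (0, x.2.1, 0, 0) := by
  have hs' : f (-A.s0) = B.s0 := by rw [map_neg, hs, neg_neg]
  have hn : -A.s0 ∈ A.Bsub := neg_mem s0_mem_Bsub
  rw [eq_inl_iff (A := A) h2 ζ₁, eq_inr_iff (A := B) h2 ζ₂, ← hs', ← hf.2.1 _ hn _ hx,
    ← hf.2.1 _ hx _ hn, ← map_neg, hf.eq_iff (bmul_mem_Bsub h2 _ hn hx) (neg_mem hx),
    hf.eq_iff (bmul_mem_Bsub h2 _ hx hn) hx, bmul_neg_left h2, bmul_neg_right h2, neg_inj,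
    neg_eq_iff_eq_neg]

lemma eq_inl_iff_of_neg (hs : f A.s0 = -B.s0) :
    f x = (0, (f x).2.1, 0, 0) ↔ x = (0, 0, x.2.2.1, 0) := by
  have hs' : f (-A.s0) = B.s0 := by rw [map_neg, hs, neg_neg]
  have hn : -A.s0 ∈ A.Bsub := neg_mem s0_mem_Bsub
  rw [eq_inr_iff (A := A) h2 ζ₁, eq_inl_iff (A := B) h2 ζ₂, ← hs', ← hf.2.1 _ hn _ hx,
    ← hf.2.1 _ hx _ hn, ← map_neg, hf.eq_iff (bmul_mem_Bsub h2 _ hn hx) hx,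
    hf.eq_iff (bmul_mem_Bsub h2 _ hx hn) (neg_mem hx), bmul_neg_left h2, bmul_neg_right h2,
    neg_inj, neg_eq_iff_eq_neg]

end

/-- An isomorphism fixing `s₀` restricts to a norm similarity `(0, J₁; 0, 0) → (0, J₂; 0, 0)`. -/
lemma exists_norm_div (h2 : (2 : F) ≠ 0) (h3 : (3 : F) ≠ 0) (hζ₂ : ζ₂ ≠ 0)
    (hf : IsBrownIso ζ₁ ζ₂ f) (hs : f A.s0 = B.s0) :
    ∃ φ : A.M →ₗ[F] B.M, Set.BijOn φ A.J B.J ∧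
      ∀ j ∈ A.J, B.norm (φ j) = ζ₁ / ζ₂ * A.norm j := by
  let φ : A.M →ₗ[F] B.M := LinearMap.fst F _ _ ∘ₗ LinearMap.snd F _ _ ∘ₗ f ∘ₗ
    LinearMap.inr F _ _ ∘ₗ LinearMap.inl F _ _
  let ψ : A.M →ₗ[F] B.M := LinearMap.fst F _ _ ∘ₗ LinearMap.snd F _ _ ∘ₗ LinearMap.snd F _ _ ∘ₗ
    f ∘ₗ LinearMap.inr F _ _ ∘ₗ LinearMap.inr F _ _ ∘ₗ LinearMap.inl F _ _
  have hφ {j : A.M} (hj : j ∈ A.J) : f (0, j, 0, 0) = (0, φ j, 0, 0) :=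
    (hf.eq_inl_iff_of_pos h2 (inl_mem_Bsub hj) hs).mpr rfl
  have hψ {j : A.M} (hj : j ∈ A.J) : f (0, 0, j, 0) = (0, 0, ψ j, 0) :=
    (hf.eq_inr_iff_of_pos h2 (inr_mem_Bsub hj) hs).mpr rfl
  refine ⟨φ, ⟨fun j hj => (hf.1.mapsTo (inl_mem_Bsub hj)).1, fun j hj k hk h => ?_,
    fun k hk => ?_⟩, fun j hj => ?_⟩
  · have := (hφ hj).trans (h ▸ (hφ hk).symm)
    exact congrArg (·.2.1) ((hf.eq_iff (inl_mem_Bsub hj) (inl_mem_Bsub hk)).mp this)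
  · obtain ⟨x, hx, hx'⟩ := hf.1.surjOn (inl_mem_Bsub hk)
    have := (hf.eq_inl_iff_of_pos h2 hx hs).mp (by rw [hx'])
    exact ⟨x.2.1, hx.1, congrArg (·.2.1) ((congrArg f this).symm.trans hx')⟩
  · have hone : f (1, 0, 0, 0) = (1, 0, 0, 0) := by
      have h₁ : ((1, 0, 0, 0) : A.Bam) = (2 : F)⁻¹ • ((1, 0, 0, 1) + A.s0) := by
        simp [s0, one_add_one_eq_two, h2]
      rw [h₁, map_smul, map_add, hf.map_one h2, hs]
      simp [s0, one_add_one_eq_two, h2]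
    have htb : ∀ j ∈ A.J, ∀ k ∈ A.J, B.tb (φ j) (ψ k) = ζ₁ / ζ₂ * A.tb j k := by
      intro j hj k hk
      have h := hf.2.1 _ (inl_mem_Bsub hj) _ (inr_mem_Bsub hk)
      rw [hφ hj, hψ hk, bmul_inl_inr h2, bmul_inl_inr h2,
        show ((ζ₁ * A.tb j k, 0, 0, 0) : A.Bam) = (ζ₁ * A.tb j k) • (1, 0, 0, 0) by simp,
        map_smul, hone] at h
      have := congrArg Prod.fst h
      simp only [Prod.smul_fst, smul_eq_mul, mul_one] at this
      field_simp
      linear_combination -this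
    have hcross : ∀ j ∈ A.J, B.cross (φ j) (φ j) = (1 : F) • ψ (A.cross j j) := by
      intro j hj
      have h := hf.2.1 _ (inl_mem_Bsub hj) _ (inl_mem_Bsub hj)
      rw [hφ hj, bmul_inl_inl h2, bmul_inl_inl h2, hψ (A.cross_mem_J h2 hj hj)] at h
      rw [one_smul]
      exact congrArg (·.2.2.1) h.symm
    rw [norm_of_tb_of_cross h2 h3 htb hcross hj, one_mul]

/-- An isomorphism negating `s₀` restricts to a norm similarity `(0, J₁; 0, 0) → (0, 0; J₂, 0)`. -/
lemma exists_norm_div_sq (h2 : (2 : F) ≠ 0) (h3 : (3 : F) ≠ 0) (hζ₂ : ζ₂ ≠ 0)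
    (hf : IsBrownIso ζ₁ ζ₂ f) (hs : f A.s0 = -B.s0) :
    ∃ φ : A.M →ₗ[F] B.M, Set.BijOn φ A.J B.J ∧
      ∀ j ∈ A.J, B.norm (φ j) = ζ₁ / ζ₂ ^ 2 * A.norm j := by
  let φ : A.M →ₗ[F] B.M := LinearMap.fst F _ _ ∘ₗ LinearMap.snd F _ _ ∘ₗ LinearMap.snd F _ _ ∘ₗ
    f ∘ₗ LinearMap.inr F _ _ ∘ₗ LinearMap.inl F _ _
  let ψ : A.M →ₗ[F] B.M := LinearMap.fst F _ _ ∘ₗ LinearMap.snd F _ _ ∘ₗ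
    f ∘ₗ LinearMap.inr F _ _ ∘ₗ LinearMap.inr F _ _ ∘ₗ LinearMap.inl F _ _
  have hφ {j : A.M} (hj : j ∈ A.J) : f (0, j, 0, 0) = (0, 0, φ j, 0) :=
    (hf.eq_inr_iff_of_neg h2 (inl_mem_Bsub hj) hs).mpr rfl
  have hψ {j : A.M} (hj : j ∈ A.J) : f (0, 0, j, 0) = (0, ψ j, 0, 0) :=
    (hf.eq_inl_iff_of_neg h2 (inr_mem_Bsub hj) hs).mpr rfl
  refine ⟨φ, ⟨fun j hj => (hf.1.mapsTo (inl_mem_Bsub hj)).2, fun j hj k hk h => ?_,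
    fun k hk => ?_⟩, fun j hj => ?_⟩
  · have := (hφ hj).trans (h ▸ (hφ hk).symm)
    exact congrArg (·.2.1) ((hf.eq_iff (inl_mem_Bsub hj) (inl_mem_Bsub hk)).mp this)
  · obtain ⟨x, hx, hx'⟩ := hf.1.surjOn (inr_mem_Bsub hk)
    have := (hf.eq_inr_iff_of_neg h2 hx hs).mp (by rw [hx'])
    exact ⟨x.2.1, hx.1, congrArg (·.2.2.1) ((congrArg f this).symm.trans hx')⟩
  · have hone : f (0, 0, 0, 1) = (1, 0, 0, 0) := by
      have h₁ : ((0, 0, 0, 1) : A.Bam) = (2 : F)⁻¹ • ((1, 0, 0, 1) - A.s0) := by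
        ext <;> simp [s0, one_add_one_eq_two, h2]
      rw [h₁, map_smul, map_sub, hf.map_one h2, hs]
      ext <;> simp [s0, one_add_one_eq_two, h2]
    have htb : ∀ j ∈ A.J, ∀ k ∈ A.J, B.tb (φ j) (ψ k) = ζ₁ / ζ₂ * A.tb j k := by
      intro j hj k hk
      have h := hf.2.1 _ (inr_mem_Bsub hk) _ (inl_mem_Bsub hj)
      rw [hφ hj, hψ hk, bmul_inl_inr h2, bmul_inr_inl h2,
        show ((0, 0, 0, ζ₁ * A.tb j k) : A.Bam) = (ζ₁ * A.tb j k) • (0, 0, 0, 1) by simp,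
        map_smul, hone] at h
      have := congrArg Prod.fst h
      simp only [Prod.smul_fst, smul_eq_mul, mul_one] at this
      rw [tb_comm]
      field_simp
      linear_combination -this
    have hcross : ∀ j ∈ A.J, B.cross (φ j) (φ j) = ζ₂⁻¹ • ψ (A.cross j j) := by
      intro j hj
      have h := hf.2.1 _ (inl_mem_Bsub hj) _ (inl_mem_Bsub hj)
      rw [hφ hj, bmul_inl_inl h2, bmul_inr_inr h2, hψ (A.cross_mem_J h2 hj hj)] at h
      rw [show ψ (A.cross j j) = ζ₂ • B.cross (φ j) (φ j) from congrArg (·.2.1) h,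
        inv_smul_smul₀ hζ₂]
    rw [norm_of_tb_of_cross h2 h3 htb hcross hj]
    field_simp

end IsBrownIso

end ReducedAlbert

/-- `B(J₁, F×F, ζ₁) ≅ B(J₂, F×F, ζ₂)` as `F`-algebras with involution if and
only if there is a norm similarity `J₁ → J₂` whose multiplier is `ζ₁/ζ₂` or `ζ₁/ζ₂²`. -/
theorem stmt2 {F : Type u} [Field F] (h2 : (2 : F) ≠ 0) (h3 : (3 : F) ≠ 0)
    (A₁ : ReducedAlbert.{u, v} F) (A₂ : ReducedAlbert.{u, v} F) (ζ₁ ζ₂ : Fˣ) :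
    -- an isomorphism of algebras with involution: a bijective F-linear map preserving
    -- products and commuting with the involutions
    (∃ f : A₁.Bam →ₗ[F] A₂.Bam,
      Set.BijOn f (A₁.Bsub : Set A₁.Bam) (A₂.Bsub : Set A₂.Bam) ∧
      (∀ x ∈ A₁.Bsub, ∀ y ∈ A₁.Bsub,
        f (A₁.bmul (ζ₁ : F) x y) = A₂.bmul (ζ₂ : F) (f x) (f y)) ∧
      (∀ x ∈ A₁.Bsub, f (A₁.binv x) = A₂.binv (f x))) ↔
    -- a norm similarity J₁ → J₂ with multiplier ζ₁/ζ₂ or ζ₁/ζ₂²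
    (∃ φ : A₁.M →ₗ[F] A₂.M,
      Set.BijOn φ (A₁.J : Set A₁.M) (A₂.J : Set A₂.M) ∧
      ((∀ j ∈ A₁.J, A₂.norm (φ j) = (ζ₁ : F) / (ζ₂ : F) * A₁.norm j) ∨
       (∀ j ∈ A₁.J, A₂.norm (φ j) = (ζ₁ : F) / ((ζ₂ : F) ^ 2) * A₁.norm j))) := by
  have hζ₁ : (ζ₁ : F) ≠ 0 := ζ₁.ne_zero
  have hζ₂ : (ζ₂ : F) ≠ 0 := ζ₂.ne_zero
  constructor
  · rintro ⟨f, hf⟩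
    replace hf : ReducedAlbert.IsBrownIso (ζ₁ : F) (ζ₂ : F) f := hf
    rcases hf.map_s0 h2 with hs | hs
    · obtain ⟨φ, hφ, hN⟩ := hf.exists_norm_div h2 h3 hζ₂ hs
      exact ⟨φ, hφ, .inl hN⟩
    · obtain ⟨φ, hφ, hN⟩ := hf.exists_norm_div_sq h2 h3 hζ₂ hs
      exact ⟨φ, hφ, .inr hN⟩
  · rintro ⟨φ, hφ, hN | hN⟩
    · exact ReducedAlbert.exists_isBrownIso_of_norm_div h2 h3 hζ₁ hζ₂ hφ hN
    · exact ReducedAlbert.exists_isBrownIso_of_norm_div_sq h2 h3 hζ₁ hζ₂ hφ hN
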